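/- In K{y_1, y_2}, for every k ≥ 1 the pure binomial y_1^{x^{k+1}} y_2 − y_1 y_2^{x^{k+1}} does not belong to the well-mixed closure ⟨y_1^x y_2 − y_1 y_2^x, y_1^{x^2} y_2 − y_1 y_2^{x^2}, …, y_1^{x^k} y_2 − y_1 y_2^{x^k}⟩. Consequently, the chain ⟨y_1^x y_2 − y_1 y_2^x⟩ ⊊ ⟨y_1^x y_2 − y_1 y_2^x, y_1^{x^2} y_2 − y_1 y_2^{x^2}⟩ ⊊ ⋯ is an infinite strictly ascending chain of well-mixed σ-ideals, and the σ-ideal I_L = [y_1^{x^i} y_2 − y_1 y_2^{x^i} : i ≥ 1] is not finitely generated as a well-mixed σ-ideal (i.e., I_L ≠ ⟨G⟩ for every finite set G ⊆ I_L). -/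

import Mathlib

open Polynomial

section SigmaRing

variable {R : Type*} [CommRing R]

/-- A σ-ideal: an ideal closed under the difference operator σ. -/
def IsSigmaIdeal (σ : R →+* R) (I : Ideal R) : Prop := ∀ a ∈ I, σ a ∈ I

/-- A σ-ideal is well-mixed if `a * b ∈ I` implies `a * σ b ∈ I`. -/
def IsWellMixed (σ : R →+* R) (I : Ideal R) : Prop := ∀ a b : R, a * b ∈ I → a * σ b ∈ I

/-- `[F]`, the smallest σ-ideal containing `F`. -/
def sigmaIdealGen (σ : R →+* R) (F : Set R) : Ideal R :=
  sInf {I : Ideal R | F ⊆ I ∧ IsSigmaIdeal σ I}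

/-- `⟨F⟩`, the smallest well-mixed σ-ideal containing `F` (well-mixed closure). -/
def wmClosure (σ : R →+* R) (F : Set R) : Ideal R :=
  sInf {I : Ideal R | F ⊆ I ∧ IsSigmaIdeal σ I ∧ IsWellMixed σ I}

/-- `⟨F⟩_r`, the smallest radical well-mixed σ-ideal containing `F`. -/
def rwmClosure (σ : R →+* R) (F : Set R) : Ideal R :=
  sInf {I : Ideal R | F ⊆ I ∧ IsSigmaIdeal σ I ∧ IsWellMixed σ I ∧ I.IsRadical}

/-- Symbolic exponent: for `p = Σ c_i x^i ∈ ℕ[x]`, `a^p = Π (σ^i a)^(c_i)`. -/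
noncomputable def sexp (σ : R →+* R) (a : R) (p : Polynomial ℕ) : R :=
  ∏ i ∈ Finset.range (p.natDegree + 1), ((⇑σ)^[i] a) ^ (p.coeff i)

/-- `I` is finitely generated as a radical well-mixed σ-ideal. -/
def FinGenAsRWM (σ : R →+* R) (I : Ideal R) : Prop :=
  ∃ G : Set R, G.Finite ∧ G ⊆ (I : Set R) ∧ I = rwmClosure σ G

/-- σ-prime: a reflexive σ-ideal which is prime. -/
def IsSigmaPrime (σ : R →+* R) (I : Ideal R) : Prop :=
  IsSigmaIdeal σ I ∧ (∀ a : R, σ a ∈ I → a ∈ I) ∧ I.IsPrime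

end SigmaRing

/-- The σ-polynomial ring `K{y_1,…,y_n}`: polynomials in variables `y_i^{x^j}`,
indexed by pairs `(i, j) ∈ Fin n × ℕ`. -/
abbrev DPoly (K : Type*) [Field K] (n : ℕ) := MvPolynomial (Fin n × ℕ) K

section DPoly

variable {K : Type*} [Field K] {n : ℕ} (σK : K →+* K)

/-- The difference operator on `K{y_1,…,y_n}` extending `σK`, with `σ(y_i^{x^j}) = y_i^{x^{j+1}}`. -/
noncomputable def shift : DPoly K n →+* DPoly K n :=
  MvPolynomial.eval₂Hom ((MvPolynomial.C : K →+* DPoly K n).comp σK)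
    (fun v => MvPolynomial.X (v.1, v.2 + 1))

/-- `y_i^p` for `p ∈ ℕ[x]`. -/
noncomputable def ypow (i : Fin n) (p : Polynomial ℕ) : DPoly K n :=
  sexp (shift σK) (MvPolynomial.X (i, 0)) p

/-- `y_i^{x^a}`. -/
noncomputable def varPow (i : Fin n) (a : ℕ) : DPoly K n :=
  ypow σK i (Polynomial.X ^ a)

/-- The monomial `Y^f = Π y_i^{f_i}` for `f ∈ ℕ[x]^n`. -/
noncomputable def monom (f : Fin n → Polynomial ℕ) : DPoly K n :=
  ∏ i, ypow σK i (f i)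

/-- A pure binomial `Y^f − Y^g`. -/
def IsPureBinomial (p : DPoly K n) : Prop :=
  ∃ f g : Fin n → Polynomial ℕ, p = monom σK f - monom σK g

/-- A binomial `a·Y^f + b·Y^g` with `a, b ∈ K^×`. -/
def IsBinomial (p : DPoly K n) : Prop :=
  ∃ (a b : K) (f g : Fin n → Polynomial ℕ), a ≠ 0 ∧ b ≠ 0 ∧
    p = MvPolynomial.C a * monom σK f + MvPolynomial.C b * monom σK g

/-- A pure binomial σ-ideal: a σ-ideal generated by pure binomials. -/
def IsPureBinomialSigmaIdeal (I : Ideal (DPoly K n)) : Prop :=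
  ∃ S : Set (DPoly K n), (∀ p ∈ S, IsPureBinomial σK p) ∧ I = sigmaIdealGen (shift σK) S

/-- Positive part of `f ∈ ℤ[x]`. -/
noncomputable def posPart (f : Polynomial ℤ) : Polynomial ℕ :=
  f.sum fun i c => Polynomial.monomial i c.toNat

/-- Negative part of `f ∈ ℤ[x]`. -/
noncomputable def negPart (f : Polynomial ℤ) : Polynomial ℕ :=
  f.sum fun i c => Polynomial.monomial i (-c).toNat

/-- The lattice σ-ideal `I_L = [Y^{f_+} − Y^{f_−} : f ∈ L]` of a ℤ[x]-lattice `L ⊆ ℤ[x]^n`. -/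
noncomputable def latticeIdeal (L : Submodule (Polynomial ℤ) (Fin n → Polynomial ℤ)) :
    Ideal (DPoly K n) :=
  sigmaIdealGen (shift σK)
    {p | ∃ f ∈ L, p = monom σK (fun i => posPart (f i)) - monom σK (fun i => negPart (f i))}

end DPoly

/-- `𝔪`: the multiplicatively closed set generated by the variables `y_i^{x^j}`. -/
def mSet (K : Type*) [Field K] (n : ℕ) : Set (DPoly K n) :=
  (Submonoid.closure (Set.range fun v : Fin n × ℕ => (MvPolynomial.X v : DPoly K n)) : Set _)

/-- `I : 𝔪 = {p : M p ∈ I for some M ∈ 𝔪}`. -/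
def colonM {K : Type*} [Field K] {n : ℕ} (I : Ideal (DPoly K n)) : Set (DPoly K n) :=
  {p | ∃ M ∈ mSet K n, M * p ∈ I}

section Tsec

variable {K : Type*} [Field K] {n t : ℕ} (σK : K →+* K)

/-- The set `T^{a_1…a_t}_{j_1…j_t}` of monomials `Y^f` with `deg f_{j_i} < a_i`. -/
def Tset (j : Fin t → Fin n) (a : Fin t → ℕ) : Set (DPoly K n) :=
  {p | ∃ f : Fin n → Polynomial ℕ,
    (∀ i : Fin t, (f (j i)).degree < (a i : WithBot ℕ)) ∧ p = monom σK f}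

/-- `I` is saturated with respect to `{y_{j_1}^{x^{a_1}},…,y_{j_t}^{x^{a_t}}}`. -/
def SaturatedWrt (j : Fin t → Fin n) (a : Fin t → ℕ) (I : Ideal (DPoly K n)) : Prop :=
  ∀ g M : DPoly K n, M ∈ Tset σK j a → M * g ∈ I → g ∈ I

/-- `J : T = {g : M g ∈ J for some M ∈ T}`. -/
def colonT (j : Fin t → Fin n) (a : Fin t → ℕ) (J : Ideal (DPoly K n)) : Set (DPoly K n) :=
  {g | ∃ M ∈ Tset σK j a, M * g ∈ J}

/-- The `T`-saturated closure `N^{a_1…a_t}_{j_1…j_t}(I)`: the smallest saturated σ-ideal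
containing `I`. -/
noncomputable def Nclosure (j : Fin t → Fin n) (a : Fin t → ℕ) (I : Ideal (DPoly K n)) :
    Ideal (DPoly K n) :=
  sInf {J : Ideal (DPoly K n) | I ≤ J ∧ IsSigmaIdeal (shift σK) J ∧ SaturatedWrt σK j a J}

/-- The set of variables `{y_{j_1}^{x^{a_1}},…,y_{j_t}^{x^{a_t}}}`. -/
noncomputable def varSet (j : Fin t → Fin n) (a : Fin t → ℕ) : Set (DPoly K n) :=
  Set.range fun i => varPow σK (j i) (a i)

/-- `⟨I₀ ∪ {y_{j_1}^{x^{a_1}},…,y_{j_t}^{x^{a_t}}}⟩_r` is quasi-normal. -/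
def QuasiNormal (j : Fin t → Fin n) (a : Fin t → ℕ) (I0 : Ideal (DPoly K n)) : Prop :=
  SaturatedWrt σK j a I0 ∧
  ∀ f g : Fin n → Polynomial ℕ, monom σK f - monom σK g ∈ I0 →
    monom σK f ∈ sigmaIdealGen (shift σK) (varSet σK j a) →
    monom σK g ∈ sigmaIdealGen (shift σK) (varSet σK j a)

end Tsec

namespace DPoly

variable {K : Type*} [Field K] {n : ℕ}

/-- The constant term of a σ-polynomial. -/
noncomputable def const : DPoly K n →+* K := MvPolynomial.constantCoeff

/-- The coefficient of a variable in the linear part of a σ-polynomial. -/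
noncomputable def lin (v : Fin n × ℕ) (p : DPoly K n) : K := const (MvPolynomial.pderiv v p)

/-- The Hessian at the origin of a σ-polynomial. -/
noncomputable def hess (v w : Fin n × ℕ) (p : DPoly K n) : K := lin v (MvPolynomial.pderiv w p)

@[simp] lemma lin_add (v : Fin n × ℕ) (p q : DPoly K n) : lin v (p + q) = lin v p + lin v q := by
  simp [lin]

@[simp] lemma lin_sub (v : Fin n × ℕ) (p q : DPoly K n) : lin v (p - q) = lin v p - lin v q := by
  simp [lin]

@[simp] lemma lin_zero (v : Fin n × ℕ) : lin v (0 : DPoly K n) = 0 := by simp [lin]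

lemma lin_mul (v : Fin n × ℕ) (p q : DPoly K n) :
    lin v (p * q) = lin v p * const q + const p * lin v q := by
  simp only [lin, Derivation.leibniz, smul_eq_mul, map_add, map_mul]
  ring

@[simp] lemma hess_add (v w : Fin n × ℕ) (p q : DPoly K n) :
    hess v w (p + q) = hess v w p + hess v w q := by
  simp [hess]

@[simp] lemma hess_sub (v w : Fin n × ℕ) (p q : DPoly K n) :
    hess v w (p - q) = hess v w p - hess v w q := by
  simp [hess]

@[simp] lemma hess_zero (v w : Fin n × ℕ) : hess v w (0 : DPoly K n) = 0 := by simp [hess]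

lemma hess_mul (v w : Fin n × ℕ) (p q : DPoly K n) :
    hess v w (p * q) =
      hess v w p * const q + lin v p * lin w q + lin w p * lin v q + const p * hess v w q := by
  simp only [hess, Derivation.leibniz, smul_eq_mul, lin_add, lin_mul]
  simp only [lin]
  ring

@[simp] lemma const_X (v : Fin n × ℕ) : const (MvPolynomial.X v : DPoly K n) = 0 := by
  simp [const]

lemma lin_X (v w : Fin n × ℕ) :
    lin v (MvPolynomial.X w : DPoly K n) = if v = w then 1 else 0 := by
  classical
  simp only [lin, MvPolynomial.pderiv_X, Pi.single_apply, @eq_comm _ w v]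
  split_ifs <;> simp

variable (σK : K →+* K)

@[simp] lemma shift_X (i : Fin n) (j : ℕ) :
    shift σK (MvPolynomial.X (i, j)) = MvPolynomial.X (i, j + 1) := by
  simp [shift]

@[simp] lemma shift_C (c : K) :
    shift σK (MvPolynomial.C c : DPoly K n) = MvPolynomial.C (σK c) := by
  simp [shift]

lemma const_shift (p : DPoly K n) : const (shift σK p) = σK (const p) := by
  induction p using MvPolynomial.induction_on with
  | C c => simp [const]
  | add p q hp hq => simp [hp, hq]
  | mul_X p v h =>
    obtain ⟨i, j⟩ := v
    simp

lemma pderiv_zero_shift (i : Fin n) (p : DPoly K n) :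
    MvPolynomial.pderiv (i, 0) (shift σK p) = 0 := by
  induction p using MvPolynomial.induction_on with
  | C c => simp
  | add p q hp hq => simp [hp, hq]
  | mul_X p v h =>
    obtain ⟨i', j⟩ := v
    have : ((i', j + 1) : Fin n × ℕ) ≠ (i, 0) := by simp
    simp [Derivation.leibniz, h, MvPolynomial.pderiv_X_of_ne this]

lemma pderiv_succ_shift (i : Fin n) (j : ℕ) (p : DPoly K n) :
    MvPolynomial.pderiv (i, j + 1) (shift σK p) = shift σK (MvPolynomial.pderiv (i, j) p) := by
  classical
  induction p using MvPolynomial.induction_on with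
  | C c => simp
  | add p q hp hq => simp [hp, hq]
  | mul_X p v h =>
    obtain ⟨i', j'⟩ := v
    simp only [map_mul, shift_X, Derivation.leibniz, h, smul_eq_mul, map_add,
      MvPolynomial.pderiv_X, Pi.single_apply, Prod.mk.injEq, add_left_inj]
    split_ifs <;> simp

@[simp] lemma lin_zero_shift (i : Fin n) (p : DPoly K n) : lin (i, 0) (shift σK p) = 0 := by
  simp [lin, pderiv_zero_shift]

@[simp] lemma lin_succ_shift (i : Fin n) (j : ℕ) (p : DPoly K n) :
    lin (i, j + 1) (shift σK p) = σK (lin (i, j) p) := by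
  simp [lin, pderiv_succ_shift, const_shift]

lemma lin_shift_eq_zero {p : DPoly K n} (h : ∀ v, lin v p = 0) (v : Fin n × ℕ) :
    lin v (shift σK p) = 0 := by
  obtain ⟨i, _ | j⟩ := v <;> simp [h]

@[simp] lemma hess_zero_left_shift (i : Fin n) (v : Fin n × ℕ) (p : DPoly K n) :
    hess (i, 0) v (shift σK p) = 0 := by
  obtain ⟨i', _ | j⟩ := v <;> simp [hess, pderiv_zero_shift, pderiv_succ_shift]

@[simp] lemma hess_zero_right_shift (i : Fin n) (v : Fin n × ℕ) (p : DPoly K n) :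
    hess v (i, 0) (shift σK p) = 0 := by
  simp [hess, pderiv_zero_shift]

@[simp] lemma hess_succ_shift (i i' : Fin n) (j j' : ℕ) (p : DPoly K n) :
    hess (i, j + 1) (i', j' + 1) (shift σK p) = σK (hess (i, j) (i', j') p) := by
  simp [hess, pderiv_succ_shift]

lemma varPow_eq_X (i : Fin n) (a : ℕ) : varPow σK i a = MvPolynomial.X (i, a) := by
  have iter (m : ℕ) :
      (⇑(shift σK))^[m] (MvPolynomial.X (i, 0) : DPoly K n) = MvPolynomial.X (i, m) := by
    induction m with
    | zero => rfl
    | succ m ih => rw [Function.iterate_succ_apply', ih, shift_X]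
  simp only [varPow, ypow, sexp, iter, Polynomial.natDegree_X_pow, Polynomial.coeff_X_pow,
    pow_ite, pow_one, pow_zero]
  rw [Finset.prod_ite_eq' (Finset.range (a + 1)) a]
  simp

/-- The bilinear form `h` on indices is a combination of minors `u_i v_j - u_j v_i` with
`|i - j| ≤ k`, where `u_i` and `v_i` are the variables of the two rows. -/
structure IsMinorForm (k : ℕ) (h : Fin 2 × ℕ → Fin 2 × ℕ → K) : Prop where
  same_row : ∀ s i j, h (s, i) (s, j) = 0
  antisymm : ∀ i j, h (0, i) (1, j) = -h (0, j) (1, i)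
  band : ∀ i j, j + k < i → h (0, i) (1, j) = 0

/-- The ideal of σ-polynomials without terms of degree below two, whose quadratic part is
a combination of minors `u_i v_j - u_j v_i` with `|i - j| ≤ k`. -/
noncomputable def minorIdeal (K : Type*) [Field K] (k : ℕ) : Ideal (DPoly K 2) where
  carrier := {p | const p = 0 ∧ (∀ v, lin v p = 0) ∧ IsMinorForm k fun v w => hess v w p}
  zero_mem' := ⟨by simp, by simp, by constructor <;> simp⟩
  add_mem' := by
    rintro p q ⟨hp, hp', hp''⟩ ⟨hq, hq', hq''⟩
    refine ⟨by simp [hp, hq], by simp [hp', hq'], ⟨fun s i j => ?_, fun i j => ?_,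
      fun i j hij => ?_⟩⟩
    · simp [hp''.same_row, hq''.same_row]
    · simp only [hess_add, hp''.antisymm i j, hq''.antisymm i j]
      ring
    · simp [hp''.band i j hij, hq''.band i j hij]
  smul_mem' := by
    rintro c p ⟨hp, hp', hp''⟩
    refine ⟨by simp [hp], by simp [lin_mul, hp, hp'], ⟨fun s i j => ?_, fun i j => ?_,
      fun i j hij => ?_⟩⟩
    · simp [hess_mul, hp, hp', hp''.same_row]
    · simp only [smul_eq_mul, hess_mul, hp, hp', hp''.antisymm i j]
      ring
    · simp [hess_mul, hp, hp', hp''.band i j hij]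

lemma mem_minorIdeal {k : ℕ} {p : DPoly K 2} :
    p ∈ minorIdeal K k ↔
      const p = 0 ∧ (∀ v, lin v p = 0) ∧ IsMinorForm k fun v w => hess v w p :=
  Iff.rfl

lemma isSigmaIdeal_minorIdeal (k : ℕ) : IsSigmaIdeal (shift σK) (minorIdeal K k) := by
  rintro p ⟨hp, hp', hp''⟩
  refine ⟨by simp [const_shift, hp], lin_shift_eq_zero σK hp', ⟨?_, ?_, ?_⟩⟩
  · rintro s (_ | i) (_ | j) <;> simp [hp''.same_row]
  · rintro (_ | i) (_ | j)
    · simp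
    · simp
    · simp
    · simp [hp''.antisymm i j]
  · rintro (_ | i) (_ | j) hij
    · simp
    · simp
    · simp
    · simp [hp''.band i j (by omega)]

lemma mem_minorIdeal_of_mul_mem {k : ℕ} {a b : DPoly K 2} (ha : const a ≠ 0)
    (hab : a * b ∈ minorIdeal K k) : b ∈ minorIdeal K k := by
  obtain ⟨h0, h1, h2⟩ := hab
  have hb : const b = 0 := by simpa [ha] using h0
  have hb' (v) : lin v b = 0 := by simpa [lin_mul, hb, ha] using h1 v
  have key (v w) : hess v w (a * b) = const a * hess v w b := by simp [hess_mul, hb, hb']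
  refine ⟨hb, hb', ⟨fun s i j => ?_, fun i j => ?_, fun i j hij => ?_⟩⟩
  · simpa [key, ha] using h2.same_row s i j
  · have := h2.antisymm i j
    simp only [key] at this
    exact mul_left_cancel₀ ha (by linear_combination this)
  · simpa [key, ha] using h2.band i j hij

lemma eq_zero_or_eq_zero_of_mul_add_mul [CharZero K] {ι : Type*} {f g : ι → K}
    (h : ∀ i j, f i * g j + f j * g i = 0) : (∀ i, f i = 0) ∨ ∀ i, g i = 0 := by
  by_contra! ⟨⟨i, hi⟩, j, hj⟩
  have hii : g i = 0 := by simpa [← two_mul, hi] using h i i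
  simpa [hii, hi, hj] using h i j

lemma lin_eq_zero_or_of_mul_mem [CharZero K] {k : ℕ} {a b : DPoly K 2} (ha : const a = 0)
    (hb : const b = 0) (hab : a * b ∈ minorIdeal K k) :
    (∀ v, lin v a = 0) ∨ ∀ v, lin v b = 0 := by
  obtain ⟨-, -, h2⟩ := hab
  have key (v w) : hess v w (a * b) = lin v a * lin w b + lin w a * lin v b := by
    simp [hess_mul, ha, hb]
  have row (s : Fin 2) : (∀ i, lin (s, i) a = 0) ∨ ∀ i, lin (s, i) b = 0 :=
    eq_zero_or_eq_zero_of_mul_add_mul fun i j => by rw [← key, h2.same_row]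
  have anti (i j) := h2.antisymm i j
  simp only [key] at anti
  have all {p : DPoly K 2} (h₀ : ∀ i, lin (0, i) p = 0) (h₁ : ∀ i, lin (1, i) p = 0) (v) :
      lin v p = 0 := by
    obtain ⟨s, i⟩ := v
    fin_cases s
    exacts [h₀ i, h₁ i]
  rcases row 0 with h₀ | h₀ <;> rcases row 1 with h₁ | h₁
  · exact Or.inl (all h₀ h₁)
  · rcases eq_zero_or_eq_zero_of_mul_add_mul (f := fun i => lin (1, i) a)
      (g := fun i => lin (0, i) b) fun i j => by
        have := anti i j
        simp only [h₀, h₁] at this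
        linear_combination this with h | h
    · exact Or.inl (all h₀ h)
    · exact Or.inr (all h h₁)
  · rcases eq_zero_or_eq_zero_of_mul_add_mul (f := fun i => lin (0, i) a)
      (g := fun i => lin (1, i) b) fun i j => by
        have := anti i j
        simp only [h₀, h₁] at this
        linear_combination this with h | h
    · exact Or.inl (all h h₁)
    · exact Or.inr (all h₀ h)
  · exact Or.inr (all h₀ h₁)

lemma isWellMixed_minorIdeal [CharZero K] (k : ℕ) :
    IsWellMixed (shift σK) (minorIdeal K k) := by
  intro a b hab
  by_cases ha : const a = 0
  · by_cases hb : const b = 0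
    · have hlin : (∀ v, lin v a = 0) ∨ ∀ v, lin v (shift σK b) = 0 :=
        (lin_eq_zero_or_of_mul_mem ha hb hab).imp_right (lin_shift_eq_zero σK)
      have hb' : const (shift σK b) = 0 := by simp [const_shift, hb]
      have key (v w) : hess v w (a * shift σK b) = 0 := by
        rcases hlin with h | h <;> simp [hess_mul, ha, hb', h]
      exact ⟨by simp [ha], by simp [lin_mul, ha, hb'], by constructor <;> simp [key]⟩
    · exact Ideal.mul_mem_right _ _ (mem_minorIdeal_of_mul_mem hb (by rwa [mul_comm]))
  · exact Ideal.mul_mem_left _ _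
      (isSigmaIdeal_minorIdeal σK k _ (mem_minorIdeal_of_mul_mem ha hab))

/-- The minor `y_1^{x^m} y_2 - y_1 y_2^{x^m}`. -/
noncomputable def minor (K : Type*) [Field K] (m : ℕ) : DPoly K 2 :=
  MvPolynomial.X (0, m) * MvPolynomial.X (1, 0) - MvPolynomial.X (0, 0) * MvPolynomial.X (1, m)

lemma hess_minor (m i j : ℕ) :
    hess (0, i) (1, j) (minor K m) =
      (if i = m ∧ j = 0 then 1 else 0) - if i = 0 ∧ j = m then 1 else 0 := by
  simp [minor, hess_mul, lin_X, ← ite_and, and_comm]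

lemma minor_mem_minorIdeal {m k : ℕ} (hm : m ≤ k) : minor K m ∈ minorIdeal K k := by
  refine ⟨by simp [minor], by simp [minor, lin_mul], ⟨fun s i j => ?_, fun i j => ?_,
    fun i j hij => ?_⟩⟩
  · fin_cases s <;> simp [minor, hess_mul, lin_X]
  · simp only [hess_minor, neg_sub, and_comm]
  · have h₁ : ¬(i = m ∧ j = 0) := by omega
    have h₂ : ¬(i = 0 ∧ j = m) := by omega
    simp [hess_minor, h₁, h₂]

lemma minor_succ_notMem_minorIdeal (k : ℕ) : minor K (k + 1) ∉ minorIdeal K k := by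
  rintro ⟨-, -, h⟩
  simpa [hess_minor] using h.band (k + 1) 0 (by omega)

end DPoly

section WellMixedClosure

variable {R : Type*} [CommRing R] {σ : R →+* R}

lemma subset_wmClosure (F : Set R) : F ⊆ wmClosure σ F := fun _ ha =>
  Submodule.mem_sInf.2 fun _ hI => hI.1 ha

lemma wmClosure_le {F : Set R} {I : Ideal R} (hF : F ⊆ I) (hσ : IsSigmaIdeal σ I)
    (hI : IsWellMixed σ I) : wmClosure σ F ≤ I :=
  sInf_le ⟨hF, hσ, hI⟩

lemma isSigmaIdeal_wmClosure (F : Set R) : IsSigmaIdeal σ (wmClosure σ F) := fun a ha =>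
  Submodule.mem_sInf.2 fun I hI => hI.2.1 a (Submodule.mem_sInf.1 ha I hI)

lemma isWellMixed_wmClosure (F : Set R) : IsWellMixed σ (wmClosure σ F) := fun a b hab =>
  Submodule.mem_sInf.2 fun I hI => hI.2.2 a b (Submodule.mem_sInf.1 hab I hI)

lemma wmClosure_le_wmClosure {F G : Set R} (h : F ⊆ wmClosure σ G) :
    wmClosure σ F ≤ wmClosure σ G :=
  wmClosure_le h (isSigmaIdeal_wmClosure G) (isWellMixed_wmClosure G)

lemma sigmaIdealGen_le {F : Set R} {I : Ideal R} (hF : F ⊆ I) (hσ : IsSigmaIdeal σ I) :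
    sigmaIdealGen σ F ≤ I :=
  sInf_le ⟨hF, hσ⟩

lemma subset_sigmaIdealGen (F : Set R) : F ⊆ sigmaIdealGen σ F := fun _ ha =>
  Submodule.mem_sInf.2 fun _ hI => hI.1 ha

lemma IsSigmaIdeal.iSup_of_monotone {I : ℕ → Ideal R} (hI : Monotone I)
    (hσ : ∀ k, IsSigmaIdeal σ (I k)) : IsSigmaIdeal σ (⨆ k, I k) := by
  intro a ha
  rw [Submodule.mem_iSup_of_directed _ hI.directed_le] at ha ⊢
  obtain ⟨k, hk⟩ := ha
  exact ⟨k, hσ k a hk⟩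

end WellMixedClosure

/-- For every `k ≥ 1`, `y_1^{x^{k+1}} y_2 − y_1 y_2^{x^{k+1}}` is not in the
well-mixed closure of `{y_1^{x^i} y_2 − y_1 y_2^{x^i} : 1 ≤ i ≤ k}`; hence these well-mixed
closures form an infinite strictly ascending chain, and
`I_L = [y_1^{x^i} y_2 − y_1 y_2^{x^i} : i ≥ 1]` is not finitely generated as a well-mixed
σ-ideal. -/
theorem stmt18 {K : Type*} [Field K] [CharZero K] (σK : K →+* K) :
    let σ : DPoly K 2 →+* DPoly K 2 := shift σK
    let b : ℕ → DPoly K 2 := fun i =>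
      varPow σK 0 i * varPow σK 1 0 - varPow σK 0 0 * varPow σK 1 i
    let B : ℕ → Set (DPoly K 2) := fun k => {p | ∃ i : ℕ, 1 ≤ i ∧ i ≤ k ∧ p = b i}
    let IL : Ideal (DPoly K 2) := sigmaIdealGen σ {p | ∃ i : ℕ, 1 ≤ i ∧ p = b i}
    (∀ k : ℕ, 1 ≤ k → b (k + 1) ∉ wmClosure σ (B k)) ∧
    (∀ k : ℕ, 1 ≤ k → wmClosure σ (B k) < wmClosure σ (B (k + 1))) ∧
    (∀ G : Set (DPoly K 2), G.Finite → G ⊆ (IL : Set (DPoly K 2)) → IL ≠ wmClosure σ G) := by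
  intro σ b B IL
  have hb (i : ℕ) : b i = DPoly.minor K i := by
    simp only [b, DPoly.varPow_eq_X, DPoly.minor]
  have hnot (k : ℕ) : b (k + 1) ∉ wmClosure σ (B k) := by
    intro h
    refine DPoly.minor_succ_notMem_minorIdeal (K := K) k ?_
    rw [← hb]
    refine wmClosure_le ?_ (DPoly.isSigmaIdeal_minorIdeal σK k)
      (DPoly.isWellMixed_minorIdeal σK k) h
    rintro _ ⟨i, -, hi, rfl⟩
    rw [hb]
    exact DPoly.minor_mem_minorIdeal hi
  have hmem {i k : ℕ} (hi : 1 ≤ i) (hik : i ≤ k) : b i ∈ wmClosure σ (B k) :=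
    subset_wmClosure _ ⟨i, hi, hik, rfl⟩
  have hmono : Monotone fun k => wmClosure σ (B k) := by
    intro k l hkl
    refine wmClosure_le_wmClosure ?_
    rintro _ ⟨i, hi, hik, rfl⟩
    exact hmem hi (hik.trans hkl)
  refine ⟨fun k _ => hnot k, fun k _ => ?_, fun G hG hGI hEq => ?_⟩
  · exact lt_of_le_of_ne (hmono k.le_succ) fun h => hnot k (h ▸ hmem (by omega) le_rfl)
  · have hIL : IL ≤ ⨆ k, wmClosure σ (B k) := by
      refine sigmaIdealGen_le ?_
        (IsSigmaIdeal.iSup_of_monotone hmono fun k => isSigmaIdeal_wmClosure _)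
      rintro _ ⟨i, hi, rfl⟩
      exact Submodule.mem_iSup_of_mem i (hmem hi le_rfl)
    have hGU : G ⊆ ⋃ k, (wmClosure σ (B k) : Set (DPoly K 2)) := fun g hg =>
      Set.mem_iUnion.2 ((Submodule.mem_iSup_of_directed _ hmono.directed_le).1 (hIL (hGI hg)))
    lift G to Finset (DPoly K 2) using hG
    obtain ⟨k, hk⟩ := Directed.exists_mem_subset_of_finset_subset_biUnion hmono.directed_le hGU
    refine hnot k (wmClosure_le_wmClosure hk ?_)
    rw [← hEq]
    exact subset_sigmaIdealGen _ ⟨k + 1, by omega, rfl⟩
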